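/- arXiv:2005.11836 — 2 statements merged into one kernel-verified Lean document; each statement's English description precedes it below -/
import Mathlib

section
/- Let w and v be classical solutions of the stiffness-only inextensible cantilever system with the same smooth forcing p, and set z = w − v. Then for all t ∈ (0,T): (d/dt)[ ‖z_t‖² + D‖z_xx‖² ] + (D/2)(d/dt)[ ‖w_x z_xx‖² + ‖v_x z_xx‖² + ‖w_xx z_x‖² + ‖v_xx z_x‖² ] = D ( w_x w_xt + v_x v_xt , z_xx² ) + D ( w_xx w_xxt + v_xx v_xxt , z_x² ) − D ( (w_xx + v_xx)(w_x + v_x) , z_x z_xxt + z_xx z_xt ). -/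
open MeasureTheory Set

/-- Spatial partial derivative of a function of `(x, t)`. -/
noncomputable def pdx (f : ℝ → ℝ → ℝ) : ℝ → ℝ → ℝ := fun x t => deriv (fun y => f y t) x

/-- Temporal partial derivative of a function of `(x, t)`. -/
noncomputable def pdt (f : ℝ → ℝ → ℝ) : ℝ → ℝ → ℝ := fun x t => deriv (fun s => f x s) t

/-- The stiffness-only inextensible cantilever operator
`w_tt + D ∂ₓ⁴w - D ∂ₓ(w_xx² w_x) + D ∂ₓ²(w_x² w_xx)`. -/
noncomputable def stiffOp (D : ℝ) (w : ℝ → ℝ → ℝ) : ℝ → ℝ → ℝ := fun x t =>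
  pdt (pdt w) x t + D * pdx (pdx (pdx (pdx w))) x t
    - D * pdx (fun y s => (pdx (pdx w) y s) ^ 2 * pdx w y s) x t
    + D * pdx (pdx (fun y s => (pdx w y s) ^ 2 * pdx (pdx w) y s)) x t

/-- A classical solution of the stiffness-only inextensible cantilever system on
`[0,L] × [0,T]` with forcing `p`: smooth on an open neighborhood of `[0,L] × [0,T]`,
satisfying the PDE pointwise and the clamped-free boundary conditions. -/
def IsStiffSol (L D T : ℝ) (p w : ℝ → ℝ → ℝ) : Prop :=
  (∃ U : Set (ℝ × ℝ), IsOpen U ∧ Icc (0:ℝ) L ×ˢ Icc (0:ℝ) T ⊆ U ∧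
      ContDiffOn ℝ (⊤ : ℕ∞) (fun q : ℝ × ℝ => w q.1 q.2) U) ∧
  (∀ x ∈ Icc (0:ℝ) L, ∀ t ∈ Icc (0:ℝ) T, stiffOp D w x t = p x t) ∧
  (∀ t ∈ Icc (0:ℝ) T,
    w 0 t = 0 ∧ pdx w 0 t = 0 ∧ pdx (pdx w) L t = 0 ∧ pdx (pdx (pdx w)) L t = 0)

open Topology Filter
open scoped Interval

/-- Smoothness at every point of `U`. -/
def Sm (U : Set (ℝ × ℝ)) (f : ℝ → ℝ → ℝ) : Prop :=
  ∀ q ∈ U, ContDiffAt ℝ (⊤ : ℕ∞) (fun q : ℝ × ℝ => f q.1 q.2) q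

lemma Sm.hx {U : Set (ℝ × ℝ)} {f : ℝ → ℝ → ℝ} (h : Sm U f) {x t : ℝ} (hq : (x, t) ∈ U) :
    HasDerivAt (fun y => f y t) (fderiv ℝ (fun q : ℝ × ℝ => f q.1 q.2) (x, t) (1, 0)) x := by
  have h1 := ((h _ hq).differentiableAt (by simp)).hasFDerivAt
  have h2 : HasDerivAt (fun y : ℝ => (y, t)) ((1 : ℝ), (0 : ℝ)) x :=
    (hasDerivAt_id x).prodMk (hasDerivAt_const x t)
  exact h1.comp_hasDerivAt x h2

lemma Sm.ht {U : Set (ℝ × ℝ)} {f : ℝ → ℝ → ℝ} (h : Sm U f) {x t : ℝ} (hq : (x, t) ∈ U) :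
    HasDerivAt (fun y => f x y) (fderiv ℝ (fun q : ℝ × ℝ => f q.1 q.2) (x, t) (0, 1)) t := by
  have h1 := ((h _ hq).differentiableAt (by simp)).hasFDerivAt
  have h2 : HasDerivAt (fun y : ℝ => (x, y)) ((0 : ℝ), (1 : ℝ)) t :=
    (hasDerivAt_const t x).prodMk (hasDerivAt_id t)
  exact h1.comp_hasDerivAt t h2

lemma Sm.pdx_eq {U : Set (ℝ × ℝ)} {f : ℝ → ℝ → ℝ} (h : Sm U f) {x t : ℝ} (hq : (x, t) ∈ U) :
    pdx f x t = fderiv ℝ (fun q : ℝ × ℝ => f q.1 q.2) (x, t) (1, 0) := (h.hx hq).deriv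

lemma Sm.pdt_eq {U : Set (ℝ × ℝ)} {f : ℝ → ℝ → ℝ} (h : Sm U f) {x t : ℝ} (hq : (x, t) ∈ U) :
    pdt f x t = fderiv ℝ (fun q : ℝ × ℝ => f q.1 q.2) (x, t) (0, 1) := (h.ht hq).deriv

lemma Sm.hasx {U : Set (ℝ × ℝ)} {f : ℝ → ℝ → ℝ} (h : Sm U f) {x t : ℝ} (hq : (x, t) ∈ U) :
    HasDerivAt (fun y => f y t) (pdx f x t) x := by
  rw [h.pdx_eq hq]; exact h.hx hq

lemma Sm.hast {U : Set (ℝ × ℝ)} {f : ℝ → ℝ → ℝ} (h : Sm U f) {x t : ℝ} (hq : (x, t) ∈ U) :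
    HasDerivAt (fun y => f x y) (pdt f x t) t := by
  rw [h.pdt_eq hq]; exact h.ht hq

lemma Sm.fd {U : Set (ℝ × ℝ)} {f : ℝ → ℝ → ℝ} (h : Sm U f) {q : ℝ × ℝ} (hq : q ∈ U) :
    ContDiffAt ℝ (⊤ : ℕ∞) (fderiv ℝ (fun q : ℝ × ℝ => f q.1 q.2)) q :=
  (h q hq).fderiv_right (by simp)

lemma Sm.dX {U : Set (ℝ × ℝ)} (hU : IsOpen U) {f : ℝ → ℝ → ℝ} (h : Sm U f) : Sm U (pdx f) := by
  intro q hq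
  have := (h.fd hq).clm_apply (contDiffAt_const (c := ((1:ℝ),(0:ℝ))))
  refine this.congr_of_eventuallyEq ?_
  filter_upwards [hU.mem_nhds hq] with r hr
  exact h.pdx_eq hr

lemma Sm.dT {U : Set (ℝ × ℝ)} (hU : IsOpen U) {f : ℝ → ℝ → ℝ} (h : Sm U f) : Sm U (pdt f) := by
  intro q hq
  have := (h.fd hq).clm_apply (contDiffAt_const (c := ((0:ℝ),(1:ℝ))))
  refine this.congr_of_eventuallyEq ?_
  filter_upwards [hU.mem_nhds hq] with r hr
  exact h.pdt_eq hr

lemma Sm.sub {U : Set (ℝ × ℝ)} {f g : ℝ → ℝ → ℝ} (hf : Sm U f) (hg : Sm U g) :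
    Sm U (fun x t => f x t - g x t) := fun q hq => (hf q hq).sub (hg q hq)
lemma Sm.add {U : Set (ℝ × ℝ)} {f g : ℝ → ℝ → ℝ} (hf : Sm U f) (hg : Sm U g) :
    Sm U (fun x t => f x t + g x t) := fun q hq => (hf q hq).add (hg q hq)
lemma Sm.mul {U : Set (ℝ × ℝ)} {f g : ℝ → ℝ → ℝ} (hf : Sm U f) (hg : Sm U g) :
    Sm U (fun x t => f x t * g x t) := fun q hq => (hf q hq).mul (hg q hq)
lemma Sm.sq {U : Set (ℝ × ℝ)} {f : ℝ → ℝ → ℝ} (hf : Sm U f) :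
    Sm U (fun x t => f x t ^ 2) := fun q hq => (hf q hq).pow 2

lemma pdx_congr {U : Set (ℝ × ℝ)} (hU : IsOpen U) {f g : ℝ → ℝ → ℝ}
    (h : ∀ x t, (x, t) ∈ U → f x t = g x t) : ∀ x t, (x, t) ∈ U → pdx f x t = pdx g x t := by
  intro x t hq
  apply Filter.EventuallyEq.deriv_eq
  have : ContinuousAt (fun y : ℝ => (y, t)) x := by fun_prop
  filter_upwards [this (hU.mem_nhds hq)] with y hy
  exact h y t hy

lemma pdt_congr {U : Set (ℝ × ℝ)} (hU : IsOpen U) {f g : ℝ → ℝ → ℝ}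
    (h : ∀ x t, (x, t) ∈ U → f x t = g x t) : ∀ x t, (x, t) ∈ U → pdt f x t = pdt g x t := by
  intro x t hq
  apply Filter.EventuallyEq.deriv_eq
  have : ContinuousAt (fun y : ℝ => (x, y)) t := by fun_prop
  filter_upwards [this (hU.mem_nhds hq)] with y hy
  exact h x y hy

lemma Sm.comm {U : Set (ℝ × ℝ)} (hU : IsOpen U) {f : ℝ → ℝ → ℝ} (h : Sm U f) :
    ∀ x t, (x, t) ∈ U → pdx (pdt f) x t = pdt (pdx f) x t := by
  intro x t hq
  have hd := ((h.fd hq).differentiableAt (by simp)).hasFDerivAt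
  have e1 : (fun q : ℝ × ℝ => pdx f q.1 q.2) =ᶠ[𝓝 (x, t)]
      fun q => fderiv ℝ (fun q : ℝ × ℝ => f q.1 q.2) q (1, 0) := by
    filter_upwards [hU.mem_nhds hq] with r hr
    exact h.pdx_eq hr
  have e2 : (fun q : ℝ × ℝ => pdt f q.1 q.2) =ᶠ[𝓝 (x, t)]
      fun q => fderiv ℝ (fun q : ℝ × ℝ => f q.1 q.2) q (0, 1) := by
    filter_upwards [hU.mem_nhds hq] with r hr
    exact h.pdt_eq hr
  rw [(h.dX hU).pdt_eq hq, (h.dT hU).pdx_eq hq, e1.fderiv_eq, e2.fderiv_eq]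
  have a1 := (hd.clm_apply (hasFDerivAt_const ((1:ℝ),(0:ℝ)) (x, t))).fderiv
  have a2 := (hd.clm_apply (hasFDerivAt_const ((0:ℝ),(1:ℝ)) (x, t))).fderiv
  rw [a1, a2]
  have := (h _ hq).isSymmSndFDerivAt (by
    rw [minSmoothness_of_isRCLikeNormedField]; exact WithTop.coe_le_coe.mpr le_top)
  simpa using this.eq (1, 0) (0, 1)

lemma Sm.contOn {U : Set (ℝ × ℝ)} {f : ℝ → ℝ → ℝ} (h : Sm U f) :
    ContinuousOn (fun q : ℝ × ℝ => f q.1 q.2) U :=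
  fun q hq => (h q hq).continuousAt.continuousWithinAt

lemma Sm.contx {U : Set (ℝ × ℝ)} {f : ℝ → ℝ → ℝ} (h : Sm U f) {L t : ℝ}
    (hs : ∀ x ∈ Icc (0:ℝ) L, (x, t) ∈ U) : ContinuousOn (fun x => f x t) (Icc 0 L) :=
  h.contOn.comp (f := fun x : ℝ => (x, t)) (by fun_prop) hs

lemma Sm.intble {U : Set (ℝ × ℝ)} {f : ℝ → ℝ → ℝ} (h : Sm U f) {L t : ℝ} (hL : 0 < L)
    (hs : ∀ x ∈ Icc (0:ℝ) L, (x, t) ∈ U) : IntervalIntegrable (fun x => f x t) volume 0 L := by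
  apply ContinuousOn.intervalIntegrable
  rw [uIcc_of_le hL.le]; exact h.contx hs

lemma Sm.leibniz {U : Set (ℝ × ℝ)} (hU : IsOpen U) {f : ℝ → ℝ → ℝ} (h : Sm U f) {L T t : ℝ}
    (hL : 0 < L) (ht : t ∈ Ioo 0 T) (hs : Icc (0:ℝ) L ×ˢ Icc (0:ℝ) T ⊆ U) :
    HasDerivAt (fun s => ∫ x in (0:ℝ)..L, f x s) (∫ x in (0:ℝ)..L, pdt f x t) t := by
  obtain ⟨C, hC⟩ := (isCompact_Icc.prod isCompact_Icc).exists_bound_of_continuousOn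
    ((h.dT hU).contOn.mono hs)
  have hio : ∀ x ∈ Ι (0:ℝ) L, x ∈ Icc (0:ℝ) L := by
    intro x hx; rw [uIoc_of_le hL.le] at hx; exact ⟨hx.1.le, hx.2⟩
  have key : ∀ s ∈ Ioo (0:ℝ) T, ∀ x ∈ Icc (0:ℝ) L, (x, s) ∈ U := fun s hs' x hx =>
    hs ⟨hx, Ioo_subset_Icc_self hs'⟩
  refine (intervalIntegral.hasDerivAt_integral_of_dominated_loc_of_deriv_le
    (F := fun s x => f x s) (F' := fun s x => pdt f x s) (bound := fun _ => C)
    (Ioo_mem_nhds ht.1 ht.2) ?_ ?_ ?_ ?_ ?_ ?_).2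
  · filter_upwards [Ioo_mem_nhds ht.1 ht.2] with s hs'
    exact (h.intble hL (key s hs')).def'.aestronglyMeasurable
  · exact h.intble hL (key t ht)
  · exact ((h.dT hU).intble hL (key t ht)).def'.aestronglyMeasurable
  · refine Eventually.of_forall fun x hx s hs' => ?_
    exact hC (x, s) ⟨hio x hx, Ioo_subset_Icc_self hs'⟩
  · exact intervalIntegrable_const
  · refine Eventually.of_forall fun x hx s hs' => ?_
    exact h.hast (key s hs' x (hio x hx))

lemma Sm.ftc {U : Set (ℝ × ℝ)} (hU : IsOpen U) {f : ℝ → ℝ → ℝ} (h : Sm U f) {L t : ℝ}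
    (hL : 0 < L) (hs : ∀ x ∈ Icc (0:ℝ) L, (x, t) ∈ U) :
    ∫ x in (0:ℝ)..L, pdx f x t = f L t - f 0 t := by
  apply intervalIntegral.integral_eq_sub_of_hasDerivAt (f := fun x => f x t)
  · intro x hx
    rw [uIcc_of_le hL.le] at hx
    exact h.hasx (hs x hx)
  · exact (h.dX hU).intble hL hs

lemma Sm.pdx_sub {U : Set (ℝ × ℝ)} {f g : ℝ → ℝ → ℝ} (hf : Sm U f) (hg : Sm U g) :
    ∀ x t, (x, t) ∈ U → pdx (fun x t => f x t - g x t) x t = pdx f x t - pdx g x t :=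
  fun _ _ hq => ((hf.hasx hq).sub (hg.hasx hq)).deriv

lemma Sm.pdt_sub {U : Set (ℝ × ℝ)} {f g : ℝ → ℝ → ℝ} (hf : Sm U f) (hg : Sm U g) :
    ∀ x t, (x, t) ∈ U → pdt (fun x t => f x t - g x t) x t = pdt f x t - pdt g x t :=
  fun _ _ hq => ((hf.hast hq).sub (hg.hast hq)).deriv

lemma Sm.pdt_sq {U : Set (ℝ × ℝ)} {f : ℝ → ℝ → ℝ} (hf : Sm U f) {x t : ℝ} (hq : (x, t) ∈ U) :
    pdt (fun x t => f x t ^ 2) x t = 2 * f x t * pdt f x t := by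
  exact (((hf.hast hq).pow 2).deriv).trans (by simp)

lemma Sm.pdt_mul_sq {U : Set (ℝ × ℝ)} {f g : ℝ → ℝ → ℝ} (hf : Sm U f) (hg : Sm U g) {x t : ℝ}
    (hq : (x, t) ∈ U) :
    pdt (fun x t => (f x t * g x t) ^ 2) x t
      = 2 * (f x t * g x t) * (pdt f x t * g x t + f x t * pdt g x t) := by
  exact ((((hf.hast hq).mul (hg.hast hq)).pow 2).deriv).trans (by simp)

lemma lin_comb (L D : ℝ) (f1 f2 f3 f4 f5 f6 f7 f8 f9 f10 : ℝ → ℝ) (hL : 0 < L)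
    (h1 : IntervalIntegrable f1 volume 0 L) (h2 : IntervalIntegrable f2 volume 0 L)
    (h3 : IntervalIntegrable f3 volume 0 L) (h4 : IntervalIntegrable f4 volume 0 L)
    (h5 : IntervalIntegrable f5 volume 0 L) (h6 : IntervalIntegrable f6 volume 0 L)
    (h7 : IntervalIntegrable f7 volume 0 L) (h8 : IntervalIntegrable f8 volume 0 L)
    (h9 : IntervalIntegrable f9 volume 0 L) (h10 : IntervalIntegrable f10 volume 0 L)
    (hz : ∫ x in (0:ℝ)..L, f10 x = 0)
    (h : ∀ x ∈ Icc (0:ℝ) L, f1 x + D * f2 x + (D/2) * (f3 x + f4 x + f5 x + f6 x)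
      + 2 * D * f10 x = D * f7 x + D * f8 x - D * f9 x) :
    (∫ x in (0:ℝ)..L, f1 x) + D * (∫ x in (0:ℝ)..L, f2 x)
      + (D/2) * ((∫ x in (0:ℝ)..L, f3 x) + (∫ x in (0:ℝ)..L, f4 x) + (∫ x in (0:ℝ)..L, f5 x)
        + (∫ x in (0:ℝ)..L, f6 x))
      = D * (∫ x in (0:ℝ)..L, f7 x) + D * (∫ x in (0:ℝ)..L, f8 x)
        - D * (∫ x in (0:ℝ)..L, f9 x) := by
  have e : ∫ x in (0:ℝ)..L, (f1 x + D * f2 x + (D/2) * (f3 x + f4 x + f5 x + f6 x)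
      + 2 * D * f10 x) = ∫ x in (0:ℝ)..L, (D * f7 x + D * f8 x - D * f9 x) := by
    apply intervalIntegral.integral_congr
    intro x hx
    rw [uIcc_of_le hL.le] at hx
    exact h x hx
  rw [intervalIntegral.integral_add
      ((h1.add (h2.const_mul D)).add ((((h3.add h4).add h5).add h6).const_mul (D/2)))
      (h10.const_mul (2 * D)),
    intervalIntegral.integral_add (h1.add (h2.const_mul D))
      ((((h3.add h4).add h5).add h6).const_mul (D/2)),
    intervalIntegral.integral_add h1 (h2.const_mul D),
    intervalIntegral.integral_sub ((h7.const_mul D).add (h8.const_mul D)) (h9.const_mul D),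
    intervalIntegral.integral_add (h7.const_mul D) (h8.const_mul D)] at e
  simp only [intervalIntegral.integral_const_mul] at e
  rw [intervalIntegral.integral_add ((h3.add h4).add h5) h6,
    intervalIntegral.integral_add (h3.add h4) h5, intervalIntegral.integral_add h3 h4, hz] at e
  linarith

lemma stiff_bdry_t {T : ℝ} {f : ℝ → ℝ → ℝ} {x t : ℝ} (ht : t ∈ Ioo 0 T)
    (h : ∀ s ∈ Icc (0:ℝ) T, f x s = 0) : pdt f x t = 0 := by
  have : (fun s => f x s) =ᶠ[𝓝 t] fun _ => 0 := by
    filter_upwards [Ioo_mem_nhds ht.1 ht.2] with s hs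
    exact h s (Ioo_subset_Icc_self hs)
  rw [pdt, this.deriv_eq]; simp

lemma stiff_B_x {U : Set (ℝ × ℝ)} (hU : IsOpen U) {w : ℝ → ℝ → ℝ} (h : Sm U w) {x t : ℝ}
    (hq : (x, t) ∈ U) (h2 : pdx (pdx w) x t = 0) (h3 : pdx (pdx (pdx w)) x t = 0) :
    pdx (fun y s => (pdx w y s) ^ 2 * pdx (pdx w) y s) x t = 0 := by
  exact (((((h.dX hU).hasx hq).pow 2).mul (((h.dX hU).dX hU).hasx hq)).deriv).trans
    (by simp [h2, h3])

/-- Symmetric difference identity (equation (4.21) of the paper) for the difference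
`z = w - v` of two classical solutions of the stiffness-only system. -/
theorem stiffness_symmetric_difference_identity
    (L D T : ℝ) (hL : 0 < L) (hD : 0 < D) (hT : 0 < T)
    (p w v : ℝ → ℝ → ℝ) (hp : ContDiff ℝ (⊤ : ℕ∞) (fun q : ℝ × ℝ => p q.1 q.2))
    (hw : IsStiffSol L D T p w) (hv : IsStiffSol L D T p v) :
    ∀ t ∈ Ioo (0:ℝ) T,
      (let z : ℝ → ℝ → ℝ := fun x t => w x t - v x t
      deriv (fun s =>
          (∫ x in (0:ℝ)..L, (pdt z x s) ^ 2)
            + D * (∫ x in (0:ℝ)..L, (pdx (pdx z) x s) ^ 2)) t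
        + (D/2) * deriv (fun s =>
            (∫ x in (0:ℝ)..L, (pdx w x s * pdx (pdx z) x s) ^ 2)
              + (∫ x in (0:ℝ)..L, (pdx v x s * pdx (pdx z) x s) ^ 2)
              + (∫ x in (0:ℝ)..L, (pdx (pdx w) x s * pdx z x s) ^ 2)
              + (∫ x in (0:ℝ)..L, (pdx (pdx v) x s * pdx z x s) ^ 2)) t
      = D * (∫ x in (0:ℝ)..L,
            (pdx w x t * pdt (pdx w) x t + pdx v x t * pdt (pdx v) x t)
              * (pdx (pdx z) x t) ^ 2)
        + D * (∫ x in (0:ℝ)..L,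
            (pdx (pdx w) x t * pdt (pdx (pdx w)) x t
                + pdx (pdx v) x t * pdt (pdx (pdx v)) x t)
              * (pdx z x t) ^ 2)
        - D * (∫ x in (0:ℝ)..L,
            ((pdx (pdx w) x t + pdx (pdx v) x t) * (pdx w x t + pdx v x t))
              * (pdx z x t * pdt (pdx (pdx z)) x t
                  + pdx (pdx z) x t * pdt (pdx z) x t))) := by
  
  intro t ht z
  obtain ⟨⟨U1, hU1, hs1, hc1⟩, hpw, hbw⟩ := hw
  obtain ⟨⟨U2, hU2, hs2, hc2⟩, hpv, hbv⟩ := hv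
  obtain ⟨U, hU, hs, sw, sv⟩ : ∃ U : Set (ℝ × ℝ), IsOpen U ∧
      Icc (0:ℝ) L ×ˢ Icc (0:ℝ) T ⊆ U ∧ Sm U w ∧ Sm U v :=
    ⟨U1 ∩ U2, hU1.inter hU2, subset_inter hs1 hs2,
      fun q hq => hc1.contDiffAt (hU1.mem_nhds hq.1),
      fun q hq => hc2.contDiffAt (hU2.mem_nhds hq.2)⟩
  have htc := Ioo_subset_Icc_self ht
  have hsl : ∀ x ∈ Icc (0:ℝ) L, (x, t) ∈ U := fun x hx => hs ⟨hx, htc⟩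
  have wx := sw.dX hU
  have vx := sv.dX hU
  have wxx := wx.dX hU
  have vxx := vx.dX hU
  have wxxx := wxx.dX hU
  have vxxx := vxx.dX hU
  have wt := sw.dT hU
  have vt := sv.dT hU
  have wtx := wt.dX hU
  have vtx := vt.dX hU
  have sz : Sm U z := sw.sub sv
  have zt := sz.dT hU
  have zx := sz.dX hU
  have zxx := zx.dX hU
  -- the cubic fluxes
  have Aw := (wxx.sq).mul wx
  have Av := (vxx.sq).mul vx
  have Bw := (wx.sq).mul wxx
  have Bv := (vx.sq).mul vxx
  have Bwx := Bw.dX hU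
  have Bvx := Bv.dX hU
  -- derivatives of z
  have ezx : ∀ x t, (x, t) ∈ U → pdx z x t = pdx w x t - pdx v x t := sw.pdx_sub sv
  have ezt : ∀ x t, (x, t) ∈ U → pdt z x t = pdt w x t - pdt v x t := sw.pdt_sub sv
  have ezxx : ∀ x t, (x, t) ∈ U → pdx (pdx z) x t = pdx (pdx w) x t - pdx (pdx v) x t :=
    fun x t hq => (pdx_congr hU ezx x t hq).trans (wx.pdx_sub vx x t hq)
  have eztt : ∀ x t, (x, t) ∈ U → pdt (pdt z) x t = pdt (pdt w) x t - pdt (pdt v) x t :=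
    fun x t hq => (pdt_congr hU ezt x t hq).trans (wt.pdt_sub vt x t hq)
  have ezxt : ∀ x t, (x, t) ∈ U → pdt (pdx z) x t = pdt (pdx w) x t - pdt (pdx v) x t :=
    fun x t hq => (pdt_congr hU ezx x t hq).trans (wx.pdt_sub vx x t hq)
  have ezxxt : ∀ x t, (x, t) ∈ U →
      pdt (pdx (pdx z)) x t = pdt (pdx (pdx w)) x t - pdt (pdx (pdx v)) x t :=
    fun x t hq => (pdt_congr hU ezxx x t hq).trans (wxx.pdt_sub vxx x t hq)
  -- commutation
  have cw := sw.comm hU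
  have cv := sv.comm hU
  have cw2 : ∀ x t, (x, t) ∈ U → pdx (pdx (pdt w)) x t = pdt (pdx (pdx w)) x t :=
    fun x t hq => (pdx_congr hU cw x t hq).trans (wx.comm hU x t hq)
  have cv2 : ∀ x t, (x, t) ∈ U → pdx (pdx (pdt v)) x t = pdt (pdx (pdx v)) x t :=
    fun x t hq => (pdx_congr hU cv x t hq).trans (vx.comm hU x t hq)
  -- the boundary flux
  have sF := ((wt.sub vt).mul (((wxxx.sub vxxx).sub (Aw.sub Av)).add (Bwx.sub Bvx))).sub
    ((wtx.sub vtx).mul ((wxx.sub vxx).add (Bw.sub Bv)))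
  have eF : ∀ x, (x, t) ∈ U → _ := fun x hq =>
    ((((wt.hasx hq).sub (vt.hasx hq)).mul
      ((((wxxx.hasx hq).sub (vxxx.hasx hq)).sub ((Aw.hasx hq).sub (Av.hasx hq))).add
        ((Bwx.hasx hq).sub (Bvx.hasx hq)))).sub
    (((wtx.hasx hq).sub (vtx.hasx hq)).mul
      (((wxx.hasx hq).sub (vxx.hasx hq)).add ((Bw.hasx hq).sub (Bv.hasx hq))))).deriv
  have hF := sF.ftc hU hL hsl
  have q0 : ((0:ℝ), t) ∈ U := hsl 0 ⟨le_rfl, hL.le⟩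
  have qL : (L, t) ∈ U := hsl L ⟨hL.le, le_rfl⟩
  have w0 : pdt w 0 t = 0 := stiff_bdry_t ht fun s hs => (hbw s hs).1
  have v0 : pdt v 0 t = 0 := stiff_bdry_t ht fun s hs => (hbv s hs).1
  have wx0 : pdx (pdt w) 0 t = 0 := by
    rw [cw 0 t q0]; exact stiff_bdry_t ht fun s hs => (hbw s hs).2.1
  have vx0 : pdx (pdt v) 0 t = 0 := by
    rw [cv 0 t q0]; exact stiff_bdry_t ht fun s hs => (hbv s hs).2.1
  obtain ⟨-, -, w2, w3⟩ := hbw t htc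
  obtain ⟨-, -, v2, v3⟩ := hbv t htc
  have bw := stiff_B_x hU sw qL w2 w3
  have bv := stiff_B_x hU sv qL v2 v3
  simp only [w0, v0, wx0, vx0, w2, w3, v2, v3, bw, bv] at hF
  norm_num at hF
  -- time derivatives
  have d1 := zt.sq.leibniz hU hL ht hs
  have d2 := zxx.sq.leibniz hU hL ht hs
  have d3 := (wx.mul zxx).sq.leibniz hU hL ht hs
  have d4 := (vx.mul zxx).sq.leibniz hU hL ht hs
  have d5 := (wxx.mul zx).sq.leibniz hU hL ht hs
  have d6 := (vxx.mul zx).sq.leibniz hU hL ht hs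
  refine Eq.trans (congrArg₂ (fun a b => a + (D/2) * b) (d1.add (d2.const_mul D)).deriv
    (((d3.add d4).add d5).add d6).deriv) ?_
  refine lin_comb L D _ _ _ _ _ _ _ _ _ _ hL
    ((zt.sq.dT hU).intble hL hsl) ((zxx.sq.dT hU).intble hL hsl)
    (((wx.mul zxx).sq.dT hU).intble hL hsl) (((vx.mul zxx).sq.dT hU).intble hL hsl)
    (((wxx.mul zx).sq.dT hU).intble hL hsl) (((vxx.mul zx).sq.dT hU).intble hL hsl)
    ((((wx.mul (wx.dT hU)).add (vx.mul (vx.dT hU))).mul zxx.sq).intble hL hsl)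
    ((((wxx.mul (wxx.dT hU)).add (vxx.mul (vxx.dT hU))).mul zx.sq).intble hL hsl)
    ((((wxx.add vxx).mul (wx.add vx)).mul
      ((zx.mul (zxx.dT hU)).add (zxx.mul (zx.dT hU)))).intble hL hsl)
    ((sF.dX hU).intble hL hsl) hF ?_
  intro x hx
  have hq := hsl x hx
  have hpde := (hpw x hx t htc).trans (hpv x hx t htc).symm
  simp only [stiffOp] at hpde
  rw [zt.pdt_sq hq, zxx.pdt_sq hq, wx.pdt_mul_sq zxx hq, vx.pdt_mul_sq zxx hq,
    wxx.pdt_mul_sq zx hq, vxx.pdt_mul_sq zx hq, ezxxt x t hq, ezxt x t hq, eztt x t hq,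
    ezt x t hq, ezxx x t hq, ezx x t hq]
  have e := eF x hq
  rw [cw2 x t hq, cv2 x t hq] at e
  simp only [Pi.sub_apply, Pi.add_apply] at e
  rw [cw x t hq, cv x t hq] at e
  refine Eq.trans (congrArg (fun r => _ + 2 * D * r) e) ?_
  beta_reduce
  linear_combination 2 * (pdt w x t - pdt v x t) * hpde
end

section
/- Let w and v be classical solutions of the stiffness-only inextensible cantilever system with the same smooth forcing p. If w(x,0) = v(x,0) and w_t(x,0) = v_t(x,0) for all x ∈ [0,L], then w(x,t) = v(x,t) for all (x,t) ∈ [0,L]×[0,T]. -/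
open MeasureTheory Set

open Filter Topology

/-- Joint smoothness of a function of two real variables. -/
def Smooth2 (f : ℝ → ℝ → ℝ) : Prop := ContDiff ℝ (⊤ : ℕ∞) (fun q : ℝ × ℝ => f q.1 q.2)

namespace Smooth2

variable {f : ℝ → ℝ → ℝ}

lemma hasFDerivAt (hf : Smooth2 f) (q : ℝ × ℝ) :
    HasFDerivAt (fun q : ℝ × ℝ => f q.1 q.2) (fderiv ℝ (fun q : ℝ × ℝ => f q.1 q.2) q) q :=
  (ContDiff.differentiable hf (by simp) q).hasFDerivAt

lemma hasDerivAt_x' (hf : Smooth2 f) (x t : ℝ) :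
    HasDerivAt (fun y => f y t) (fderiv ℝ (fun q : ℝ × ℝ => f q.1 q.2) (x, t) (1, 0)) x := by
  have h2 : HasDerivAt (fun y : ℝ => (y, t)) ((1 : ℝ), (0 : ℝ)) x :=
    (hasDerivAt_id x).prodMk (hasDerivAt_const x t)
  exact (hf.hasFDerivAt (x, t)).comp_hasDerivAt x h2

lemma hasDerivAt_t' (hf : Smooth2 f) (x t : ℝ) :
    HasDerivAt (fun s => f x s) (fderiv ℝ (fun q : ℝ × ℝ => f q.1 q.2) (x, t) (0, 1)) t := by
  have h2 : HasDerivAt (fun y : ℝ => (x, y)) ((0 : ℝ), (1 : ℝ)) t :=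
    (hasDerivAt_const t x).prodMk (hasDerivAt_id t)
  exact (hf.hasFDerivAt (x, t)).comp_hasDerivAt t h2

lemma pdx_eq (hf : Smooth2 f) (x t : ℝ) :
    pdx f x t = fderiv ℝ (fun q : ℝ × ℝ => f q.1 q.2) (x, t) (1, 0) :=
  (hf.hasDerivAt_x' x t).deriv

lemma pdt_eq (hf : Smooth2 f) (x t : ℝ) :
    pdt f x t = fderiv ℝ (fun q : ℝ × ℝ => f q.1 q.2) (x, t) (0, 1) :=
  (hf.hasDerivAt_t' x t).deriv

lemma hx (hf : Smooth2 f) (x t : ℝ) : HasDerivAt (fun y => f y t) (pdx f x t) x := by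
  rw [hf.pdx_eq]; exact hf.hasDerivAt_x' x t

lemma ht (hf : Smooth2 f) (x t : ℝ) : HasDerivAt (fun s => f x s) (pdt f x t) t := by
  rw [hf.pdt_eq]; exact hf.hasDerivAt_t' x t

lemma fderiv_smooth (hf : Smooth2 f) :
    ContDiff ℝ (⊤ : ℕ∞) (fderiv ℝ (fun q : ℝ × ℝ => f q.1 q.2)) :=
  ContDiff.fderiv_right (m := ((⊤ : ℕ∞) : WithTop ℕ∞)) hf (by simp)

lemma dx (hf : Smooth2 f) : Smooth2 (pdx f) := by
  unfold Smooth2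
  simp only [hf.pdx_eq]
  exact hf.fderiv_smooth.clm_apply contDiff_const

lemma dt (hf : Smooth2 f) : Smooth2 (pdt f) := by
  unfold Smooth2
  simp only [hf.pdt_eq]
  exact hf.fderiv_smooth.clm_apply contDiff_const

lemma comm (hf : Smooth2 f) : pdt (pdx f) = pdx (pdt f) := by
  funext x t
  rw [hf.dx.pdt_eq, hf.dt.pdx_eq]
  simp only [hf.pdx_eq, hf.pdt_eq, Prod.mk.eta]
  have hd : DifferentiableAt ℝ (fderiv ℝ (fun q : ℝ × ℝ => f q.1 q.2)) (x, t) :=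
    hf.fderiv_smooth.differentiable (by simp) _
  have hs : IsSymmSndFDerivAt ℝ (fun q : ℝ × ℝ => f q.1 q.2) (x, t) :=
    ContDiffAt.isSymmSndFDerivAt (ContDiff.contDiffAt hf)
      (by simpa using (WithTop.coe_le_coe.2 (le_top : (2 : ℕ∞) ≤ ⊤)))
  rw [fderiv_clm_apply hd (differentiableAt_const _), fderiv_clm_apply hd (differentiableAt_const _)]
  simpa using hs (0, 1) (1, 0)

lemma cont (hf : Smooth2 f) : Continuous (fun q : ℝ × ℝ => f q.1 q.2) := ContDiff.continuous hf

lemma cont_x (hf : Smooth2 f) (t : ℝ) : Continuous (fun x => f x t) :=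
  hf.cont.comp (by fun_prop : Continuous fun x : ℝ => (x, t))

lemma hasDerivAt_integral (hf : Smooth2 f) (L t : ℝ) :
    HasDerivAt (fun s => ∫ x in (0:ℝ)..L, f x s) (∫ x in (0:ℝ)..L, pdt f x t) t := by
  obtain ⟨M, hM⟩ := (isCompact_uIcc (a := (0:ℝ)) (b := L)).prod
    (isCompact_Icc (a := t - 1) (b := t + 1)) |>.exists_bound_of_continuousOn
    (hf.dt.cont.continuousOn)
  refine (intervalIntegral.hasDerivAt_integral_of_dominated_loc_of_deriv_le
    (F := fun s x => f x s) (F' := fun s x => pdt f x s) (bound := fun _ => M)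
    (s := Icc (t - 1) (t + 1)) (Icc_mem_nhds (by linarith) (by linarith)) ?_ ?_ ?_ ?_ ?_ ?_).2
  · exact Eventually.of_forall fun s => (hf.cont_x s).aestronglyMeasurable
  · exact (hf.cont_x t).intervalIntegrable _ _
  · exact (hf.dt.cont_x t).aestronglyMeasurable
  · exact Eventually.of_forall fun x hx s hs => hM (x, s) ⟨uIoc_subset_uIcc hx, hs⟩
  · exact intervalIntegrable_const
  · exact Eventually.of_forall fun x _ s _ => hf.ht x s

end Smooth2

/-- The derivative of a function vanishing on a nondegenerate interval vanishes there. -/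
lemma deriv_zero_of_zero_on {f : ℝ → ℝ} {f' a b x : ℝ} (hab : a < b) (hx : x ∈ Icc a b)
    (h : ∀ y ∈ Icc a b, f y = 0) (hf : HasDerivAt f f' x) : f' = 0 := by
  have h1 : HasDerivWithinAt f 0 (Icc a b) x :=
    (hasDerivWithinAt_const x (Icc a b) (0:ℝ)).congr h (h x hx)
  exact ((uniqueDiffOn_Icc hab) x hx).eq_deriv _ hf.hasDerivWithinAt h1

lemma poincare {f f' : ℝ → ℝ} {L : ℝ} (hL : 0 < L) (hf : ∀ x, HasDerivAt f (f' x) x)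
    (hf' : Continuous f') (h0 : f 0 = 0) :
    ∫ x in (0:ℝ)..L, f x ^ 2 ≤ ∫ x in (0:ℝ)..L, 4 * L ^ 2 * f' x ^ 2 := by
  have hc : Continuous f := continuous_iff_continuousAt.2 fun x => (hf x).continuousAt
  have hd : ∀ x ∈ uIcc 0 L, HasDerivAt (fun x => (x - L) * f x ^ 2)
      (f x ^ 2 + 2 * (x - L) * f x * f' x) x := by
    intro x _
    refine (((hasDerivAt_id x).sub_const L).mul ((hf x).pow 2)).congr_deriv ?_
    simp; ring
  have hi := intervalIntegral.integral_eq_sub_of_hasDerivAt hd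
    ((by fun_prop : Continuous _).intervalIntegrable _ _)
  simp only [sub_self, zero_mul, h0] at hi
  have : ∫ x in (0:ℝ)..L, (f x ^ 2 - 4 * L ^ 2 * f' x ^ 2) ≤
      ∫ x in (0:ℝ)..L, 2 * (f x ^ 2 + 2 * (x - L) * f x * f' x) := by
    apply intervalIntegral.integral_mono_on hL.le
    · exact (by fun_prop : Continuous _).intervalIntegrable _ _
    · exact (by fun_prop : Continuous _).intervalIntegrable _ _
    · intro x hx
      have h1 : (x - L) ^ 2 ≤ L ^ 2 := by nlinarith [hx.1, hx.2]
      nlinarith [sq_nonneg (f x + 2 * (x - L) * f' x), mul_le_mul_of_nonneg_right h1 (sq_nonneg (f' x))]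
  rw [intervalIntegral.integral_const_mul, hi, intervalIntegral.integral_sub
    ((by fun_prop : Continuous _).intervalIntegrable _ _)
    ((by fun_prop : Continuous _).intervalIntegrable _ _)] at this
  simpa using this

/-- Locality. -/
lemma pdx_congr_s12 {f g : ℝ → ℝ → ℝ} {q : ℝ × ℝ}
    (h : ∀ᶠ r in 𝓝 q, f r.1 r.2 = g r.1 r.2) : ∀ᶠ r in 𝓝 q, pdx f r.1 r.2 = pdx g r.1 r.2 := by
  filter_upwards [h.eventually_nhds] with r hr
  have : Tendsto (fun y : ℝ => (y, r.2)) (𝓝 r.1) (𝓝 r) :=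
    (by fun_prop : Continuous fun y : ℝ => (y, r.2)).tendsto r.1
  exact Filter.EventuallyEq.deriv_eq (this.eventually hr)

lemma pdt_congr_s12 {f g : ℝ → ℝ → ℝ} {q : ℝ × ℝ}
    (h : ∀ᶠ r in 𝓝 q, f r.1 r.2 = g r.1 r.2) : ∀ᶠ r in 𝓝 q, pdt f r.1 r.2 = pdt g r.1 r.2 := by
  filter_upwards [h.eventually_nhds] with r hr
  have : Tendsto (fun y : ℝ => (r.1, y)) (𝓝 r.2) (𝓝 r) :=
    (by fun_prop : Continuous fun y : ℝ => (r.1, y)).tendsto r.2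
  exact Filter.EventuallyEq.deriv_eq (this.eventually hr)

lemma stiffOp_congr {f g : ℝ → ℝ → ℝ} {q : ℝ × ℝ} (D : ℝ)
    (h : ∀ᶠ r in 𝓝 q, f r.1 r.2 = g r.1 r.2) : stiffOp D f q.1 q.2 = stiffOp D g q.1 q.2 := by
  have h1 := pdx_congr_s12 h
  have h2 := pdx_congr_s12 h1
  have h4 := pdx_congr_s12 (pdx_congr_s12 h2)
  have ht := pdt_congr_s12 (pdt_congr_s12 h)
  have hA : ∀ᶠ r in 𝓝 q, (fun y s => (pdx (pdx f) y s) ^ 2 * pdx f y s) r.1 r.2 =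
      (fun y s => (pdx (pdx g) y s) ^ 2 * pdx g y s) r.1 r.2 := by
    filter_upwards [h1, h2] with r a b
    simp only [a, b]
  have hB : ∀ᶠ r in 𝓝 q, (fun y s => (pdx f y s) ^ 2 * pdx (pdx f) y s) r.1 r.2 =
      (fun y s => (pdx g y s) ^ 2 * pdx (pdx g) y s) r.1 r.2 := by
    filter_upwards [h1, h2] with r a b
    simp only [a, b]
  unfold stiffOp
  have r1 := h4.self_of_nhds
  have r2 := ht.self_of_nhds
  have r3 := Filter.Eventually.self_of_nhds (pdx_congr_s12 (f := fun y s => (pdx (pdx f) y s) ^ 2 * pdx f y s)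
    (g := fun y s => (pdx (pdx g) y s) ^ 2 * pdx g y s) hA)
  have r4 := Filter.Eventually.self_of_nhds (pdx_congr_s12 (pdx_congr_s12
    (f := fun y s => (pdx f y s) ^ 2 * pdx (pdx f) y s)
    (g := fun y s => (pdx g y s) ^ 2 * pdx (pdx g) y s) hB))
  rw [r1, r2, r3, r4]

/-- Globally smooth extension agreeing near the rectangle. -/
lemma exists_ext {w : ℝ → ℝ → ℝ} {K U : Set (ℝ × ℝ)} (hK : IsClosed K) (hU : IsOpen U)
    (hKU : K ⊆ U) (hw : ContDiffOn ℝ (⊤ : ℕ∞) (fun q : ℝ × ℝ => w q.1 q.2) U) :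
    ∃ W : ℝ → ℝ → ℝ, Smooth2 W ∧ ∀ q ∈ K, ∀ᶠ r in 𝓝 q, W r.1 r.2 = w r.1 r.2 := by
  obtain ⟨V, hV, hKV, hVU⟩ := normal_exists_closure_subset hK hU hKU
  obtain ⟨χ, h1, h0, -⟩ := exists_contMDiffMap_one_nhds_of_subset_interior
    (n := (⊤ : ℕ∞)) (modelWithCornersSelf ℝ (ℝ × ℝ)) (s := K) (t := V) hK
    (by rwa [hV.interior_eq])
  have hχ : ContDiff ℝ (⊤ : ℕ∞) (χ : ℝ × ℝ → ℝ) := χ.contMDiff.contDiff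
  refine ⟨fun x t => χ (x, t) * w x t, ?_, ?_⟩
  · unfold Smooth2
    rw [contDiff_iff_contDiffAt]
    intro q
    by_cases hq : q ∈ closure V
    · exact hχ.contDiffAt.mul (hw.contDiffAt (hU.mem_nhds (hVU hq)))
    · have : (fun q : ℝ × ℝ => χ (q.1, q.2) * w q.1 q.2) =ᶠ[𝓝 q] fun _ => 0 := by
        filter_upwards [isClosed_closure.isOpen_compl.mem_nhds hq] with r hr
        have : χ r = 0 := h0 r fun h => hr (subset_closure h)
        simp [this]
      exact contDiffAt_const.congr_of_eventuallyEq this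
  · intro q hq
    filter_upwards [(eventually_nhdsSet_iff_forall.1 h1) q hq] with r hr
    simp [hr]

section Core

variable {w v : ℝ → ℝ → ℝ}

/-- The stiffness operator with all derivatives expanded. -/
lemma stiffOp_expand (hw : Smooth2 w) (D x t : ℝ) :
    stiffOp D w x t = pdt (pdt w) x t + D * (pdx (pdx (pdx (pdx w))) x t
      + pdx (pdx w) x t ^ 3 + 4 * pdx w x t * pdx (pdx w) x t * pdx (pdx (pdx w)) x t
      + pdx w x t ^ 2 * pdx (pdx (pdx (pdx w))) x t) := by
  have e1 : pdx (fun y s => (pdx (pdx w) y s) ^ 2 * pdx w y s) = fun x t =>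
      2 * pdx (pdx w) x t * pdx (pdx (pdx w)) x t * pdx w x t + pdx (pdx w) x t ^ 3 := by
    funext x t
    refine HasDerivAt.deriv (((hw.dx.dx.hx x t).pow 2 |>.mul (hw.dx.hx x t)).congr_deriv ?_)
    simp; ring
  have e2 : pdx (fun y s => (pdx w y s) ^ 2 * pdx (pdx w) y s) = fun x t =>
      2 * (pdx w x t * pdx (pdx w) x t ^ 2) + pdx w x t ^ 2 * pdx (pdx (pdx w)) x t := by
    funext x t
    refine HasDerivAt.deriv (((hw.dx.hx x t).pow 2 |>.mul (hw.dx.dx.hx x t)).congr_deriv ?_)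
    simp; ring
  have e3 : pdx (fun x t =>
      2 * (pdx w x t * pdx (pdx w) x t ^ 2) + pdx w x t ^ 2 * pdx (pdx (pdx w)) x t) = fun x t =>
      2 * pdx (pdx w) x t ^ 3 + 6 * pdx w x t * pdx (pdx w) x t * pdx (pdx (pdx w)) x t
      + pdx w x t ^ 2 * pdx (pdx (pdx (pdx w))) x t := by
    funext x t
    refine HasDerivAt.deriv ((((((hw.dx.hx x t).mul ((hw.dx.dx.hx x t).pow 2))).const_mul 2).add
      (((hw.dx.hx x t).pow 2).mul (hw.dx.dx.dx.hx x t))).congr_deriv ?_)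
    simp; ring
  unfold stiffOp
  rw [e1, e2, e3]
  ring

/-- Averaged stiffness coefficient. -/
noncomputable def cA (w v : ℝ → ℝ → ℝ) (x t : ℝ) : ℝ :=
  1 + (pdx w x t ^ 2 + pdx w x t * pdx v x t + pdx v x t ^ 2) / 3

/-- Its spatial derivative. -/
noncomputable def cAx (w v : ℝ → ℝ → ℝ) (x t : ℝ) : ℝ :=
  (2 * pdx w x t * pdx (pdx w) x t + pdx (pdx w) x t * pdx v x t
    + pdx w x t * pdx (pdx v) x t + 2 * pdx v x t * pdx (pdx v) x t) / 3

/-- Its temporal derivative. -/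
noncomputable def cAt (w v : ℝ → ℝ → ℝ) (x t : ℝ) : ℝ :=
  (2 * pdx w x t * pdx (pdt w) x t + pdx (pdt w) x t * pdx v x t
    + pdx w x t * pdx (pdt v) x t + 2 * pdx v x t * pdx (pdt v) x t) / 3

/-- Lower order coefficient. -/
noncomputable def cG (w v : ℝ → ℝ → ℝ) (x t : ℝ) : ℝ :=
  (pdx (pdx w) x t ^ 2 + pdx (pdx w) x t * pdx (pdx v) x t + pdx (pdx v) x t ^ 2
    + 2 * pdx w x t * pdx (pdx (pdx w)) x t + pdx (pdx (pdx w)) x t * pdx v x t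
    + pdx w x t * pdx (pdx (pdx v)) x t + 2 * pdx v x t * pdx (pdx (pdx v)) x t) / 3

/-- Second spatial derivative of the stiffness coefficient. -/
noncomputable def cAxx (w v : ℝ → ℝ → ℝ) (x t : ℝ) : ℝ :=
  cG w v x t
    + (pdx (pdx w) x t ^ 2 + pdx (pdx w) x t * pdx (pdx v) x t + pdx (pdx v) x t ^ 2) / 3

/-- Spatial derivative of the lower order coefficient. -/
noncomputable def cGx (w v : ℝ → ℝ → ℝ) (x t : ℝ) : ℝ :=
  (4 * pdx (pdx w) x t * pdx (pdx (pdx w)) x t + 2 * pdx (pdx (pdx w)) x t * pdx (pdx v) x t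
    + 2 * pdx (pdx w) x t * pdx (pdx (pdx v)) x t + 4 * pdx (pdx v) x t * pdx (pdx (pdx v)) x t
    + 2 * pdx w x t * pdx (pdx (pdx (pdx w))) x t + pdx (pdx (pdx (pdx w))) x t * pdx v x t
    + pdx w x t * pdx (pdx (pdx (pdx v))) x t
    + 2 * pdx v x t * pdx (pdx (pdx (pdx v))) x t) / 3

/-- Energy density. -/
noncomputable def eDens (D : ℝ) (w v : ℝ → ℝ → ℝ) (x t : ℝ) : ℝ :=
  (pdt w x t - pdt v x t) ^ 2 + D * (cA w v x t * (pdx (pdx w) x t - pdx (pdx v) x t) ^ 2)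

/-- Energy flux. -/
noncomputable def eFlux (w v : ℝ → ℝ → ℝ) (x t : ℝ) : ℝ :=
  cA w v x t * (pdx (pdx w) x t - pdx (pdx v) x t) * (pdx (pdt w) x t - pdx (pdt v) x t)
    - (pdt w x t - pdt v x t) * (cAx w v x t * (pdx (pdx w) x t - pdx (pdx v) x t)
      + cA w v x t * (pdx (pdx (pdx w)) x t - pdx (pdx (pdx v)) x t))

/-- Spatial derivative of the energy flux. -/
noncomputable def eFluxX (w v : ℝ → ℝ → ℝ) (x t : ℝ) : ℝ :=
  cA w v x t * (pdx (pdx w) x t - pdx (pdx v) x t)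
      * (pdx (pdx (pdt w)) x t - pdx (pdx (pdt v)) x t)
    - (pdt w x t - pdt v x t) * (cAxx w v x t * (pdx (pdx w) x t - pdx (pdx v) x t)
      + 2 * cAx w v x t * (pdx (pdx (pdx w)) x t - pdx (pdx (pdx v)) x t)
      + cA w v x t * (pdx (pdx (pdx (pdx w))) x t - pdx (pdx (pdx (pdx v))) x t))

/-- Remainder in the energy identity. -/
noncomputable def eRem (D : ℝ) (w v : ℝ → ℝ → ℝ) (x t : ℝ) : ℝ :=
  D * cAt w v x t * (pdx (pdx w) x t - pdx (pdx v) x t) ^ 2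
    - 2 * D * (pdt w x t - pdt v x t) * (cGx w v x t * (pdx w x t - pdx v x t)
      + cG w v x t * (pdx (pdx w) x t - pdx (pdx v) x t))

lemma cA_x (hw : Smooth2 w) (hv : Smooth2 v) (x t : ℝ) :
    HasDerivAt (fun y => cA w v y t) (cAx w v x t) x := by
  refine ((((((hw.dx.hx x t).pow 2).add ((hw.dx.hx x t).mul (hv.dx.hx x t))).add
    ((hv.dx.hx x t).pow 2)).div_const 3).const_add 1).congr_deriv ?_
  simp [cAx]; ring

lemma cA_t (hw : Smooth2 w) (hv : Smooth2 v) (x t : ℝ) :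
    HasDerivAt (fun s => cA w v x s) (cAt w v x t) t := by
  refine ((((((hw.dx.ht x t).pow 2).add ((hw.dx.ht x t).mul (hv.dx.ht x t))).add
    ((hv.dx.ht x t).pow 2)).div_const 3).const_add 1).congr_deriv ?_
  simp [cAt, hw.comm, hv.comm]; ring

lemma cAx_x (hw : Smooth2 w) (hv : Smooth2 v) (x t : ℝ) :
    HasDerivAt (fun y => cAx w v y t) (cAxx w v x t) x := by
  refine (((((((hw.dx.hx x t).const_mul 2).mul (hw.dx.dx.hx x t)).add
    ((hw.dx.dx.hx x t).mul (hv.dx.hx x t))).add ((hw.dx.hx x t).mul (hv.dx.dx.hx x t))).add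
    (((hv.dx.hx x t).const_mul 2).mul (hv.dx.dx.hx x t))).div_const 3).congr_deriv ?_
  simp [cAxx, cG]; ring

lemma eFlux_x (hw : Smooth2 w) (hv : Smooth2 v) (x t : ℝ) :
    HasDerivAt (fun y => eFlux w v y t) (eFluxX w v x t) x := by
  have hA := cA_x hw hv x t
  have hAx := cAx_x hw hv x t
  have h2 := (hw.dx.dx.hx x t).sub (hv.dx.dx.hx x t)
  have h3 := (hw.dx.dx.dx.hx x t).sub (hv.dx.dx.dx.hx x t)
  refine (((hA.mul h2).mul ((hw.dt.dx.hx x t).sub (hv.dt.dx.hx x t))).sub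
    (((hw.dt.hx x t).sub (hv.dt.hx x t)).mul ((hAx.mul h2).add (hA.mul h3)))).congr_deriv ?_
  simp [eFluxX]; ring

lemma eDens_t (hw : Smooth2 w) (hv : Smooth2 v) (D x t : ℝ)
    (h : stiffOp D w x t = stiffOp D v x t) :
    HasDerivAt (fun s => eDens D w v x s) (2 * D * eFluxX w v x t + eRem D w v x t) t := by
  have hA := cA_t hw hv x t
  have h2 := (hw.dx.dx.ht x t).sub (hv.dx.dx.ht x t)
  refine ((((hw.dt.ht x t).sub (hv.dt.ht x t)).pow 2).add
    ((hA.mul (h2.pow 2)).const_mul D)).congr_deriv ?_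
  rw [stiffOp_expand hw, stiffOp_expand hv] at h
  simp only [eFluxX, eRem, hw.dx.comm, hv.dx.comm, hw.comm, hv.comm, cAxx, cG, cGx, cAx, cA]
  simp
  linear_combination (2 * (pdt w x t - pdt v x t)) * h

lemma eDens_smooth (hw : Smooth2 w) (hv : Smooth2 v) (D : ℝ) : Smooth2 (eDens D w v) := by
  have a := hw.dt
  have b := hv.dt
  have c := hw.dx
  have d := hv.dx
  have e := hw.dx.dx
  have f := hv.dx.dx
  unfold Smooth2 eDens cA at *
  fun_prop

lemma coeff_bound (hw : Smooth2 w) (hv : Smooth2 v) (D L T : ℝ) : ∃ M : ℝ, 0 ≤ M ∧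
    ∀ x ∈ Icc 0 L, ∀ t ∈ Icc 0 T, |D * cAt w v x t| ≤ M ∧ |2 * D * cGx w v x t| ≤ M ∧
      |2 * D * cG w v x t| ≤ M := by
  have hc : ∀ f : ℝ × ℝ → ℝ, Continuous f → ∃ M : ℝ, ∀ x ∈ Icc 0 L, ∀ t ∈ Icc 0 T,
      |f (x, t)| ≤ M := by
    intro f hf
    obtain ⟨M, hM⟩ := ((isCompact_Icc (a := (0:ℝ)) (b := L)).prod
      (isCompact_Icc (a := (0:ℝ)) (b := T))).exists_bound_of_continuousOn hf.continuousOn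
    exact ⟨M, fun x hx t ht => hM (x, t) ⟨hx, ht⟩⟩
  have w1 := hw.dx.cont
  have w2 := hw.dx.dx.cont
  have w3 := hw.dx.dx.dx.cont
  have w4 := hw.dx.dx.dx.dx.cont
  have v1 := hv.dx.cont
  have v2 := hv.dx.dx.cont
  have v3 := hv.dx.dx.dx.cont
  have v4 := hv.dx.dx.dx.dx.cont
  have wt := hw.dt.dx.cont
  have vt := hv.dt.dx.cont
  obtain ⟨M1, h1⟩ := hc (fun q => D * cAt w v q.1 q.2) (by unfold cAt; fun_prop)
  obtain ⟨M2, h2⟩ := hc (fun q => 2 * D * cGx w v q.1 q.2) (by unfold cGx; fun_prop)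
  obtain ⟨M3, h3⟩ := hc (fun q => 2 * D * cG w v q.1 q.2) (by unfold cG; fun_prop)
  refine ⟨|M1| + |M2| + |M3|, by positivity, fun x hx t ht => ⟨?_, ?_, ?_⟩⟩
  · linarith [h1 x hx t ht, le_abs_self M1, abs_nonneg M2, abs_nonneg M3]
  · linarith [h2 x hx t ht, le_abs_self M2, abs_nonneg M1, abs_nonneg M3]
  · linarith [h3 x hx t ht, le_abs_self M3, abs_nonneg M2, abs_nonneg M1]

lemma cA_ge (x t : ℝ) : 1 ≤ cA w v x t := by
  unfold cA
  nlinarith [sq_nonneg (pdx w x t + pdx v x t), sq_nonneg (pdx w x t), sq_nonneg (pdx v x t)]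

lemma rem_alg {M α β γ z p q : ℝ} (h1 : |α| ≤ M) (h2 : |β| ≤ M) (h3 : |γ| ≤ M) :
    α * q ^ 2 - z * (β * p + γ * q) ≤ M * (z ^ 2 + p ^ 2 + 2 * q ^ 2) := by
  rw [abs_le] at *
  have a1 : α * q ^ 2 ≤ M * q ^ 2 := mul_le_mul_of_nonneg_right h1.2 (sq_nonneg q)
  have key : ∀ β y : ℝ, -M ≤ β ∧ β ≤ M → -(β * (z * y)) ≤ M * ((z ^ 2 + y ^ 2) / 2) := by
    intro β y hb
    nlinarith [mul_nonneg (sub_nonneg.2 hb.2) (sq_nonneg (z - y)),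
      mul_nonneg (by linarith [hb.1] : 0 ≤ β + M) (sq_nonneg (z + y))]
  have hM : 0 ≤ M := by linarith [h1.1, h1.2]
  nlinarith [key β p h2, key γ q h3, mul_nonneg hM (sq_nonneg p), mul_nonneg hM (sq_nonneg q)]

/-- Uniqueness for globally smooth functions. -/
lemma core (hw : Smooth2 w) (hv : Smooth2 v) {L D T : ℝ} (hL : 0 < L) (hD : 0 < D) (hT : 0 < T)
    (hpde : ∀ x ∈ Icc (0:ℝ) L, ∀ t ∈ Icc (0:ℝ) T, stiffOp D w x t = stiffOp D v x t)
    (hb0 : ∀ t ∈ Icc (0:ℝ) T, w 0 t = v 0 t) (hb1 : ∀ t ∈ Icc (0:ℝ) T, pdx w 0 t = pdx v 0 t)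
    (hb2 : ∀ t ∈ Icc (0:ℝ) T, pdx (pdx w) L t = pdx (pdx v) L t)
    (hb3 : ∀ t ∈ Icc (0:ℝ) T, pdx (pdx (pdx w)) L t = pdx (pdx (pdx v)) L t)
    (h0 : ∀ x ∈ Icc (0:ℝ) L, w x 0 = v x 0)
    (h1 : ∀ x ∈ Icc (0:ℝ) L, pdt w x 0 = pdt v x 0) :
    ∀ x ∈ Icc (0:ℝ) L, ∀ t ∈ Icc (0:ℝ) T, w x t = v x t := by
  have he := eDens_smooth hw hv D
  have hpos : ∀ x t, 0 ≤ eDens D w v x t := fun x t => by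
    have := cA_ge (w := w) (v := v) x t
    unfold eDens
    positivity
  obtain ⟨M, hM0, hM⟩ := coeff_bound hw hv D L T
  set E : ℝ → ℝ := fun t => ∫ x in (0:ℝ)..L, eDens D w v x t with hE
  have hEd : ∀ t, HasDerivAt E (∫ x in (0:ℝ)..L, pdt (eDens D w v) x t) t :=
    he.hasDerivAt_integral L
  set C : ℝ := M * (1 + (2 + 4 * L ^ 2) / D) with hC
  -- the energy inequality
  have hineq : ∀ t ∈ Icc (0:ℝ) T, (∫ x in (0:ℝ)..L, pdt (eDens D w v) x t) ≤ C * E t := by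
    intro t ht
    have cw1 := hw.dx.cont_x t
    have cw2 := hw.dx.dx.cont_x t
    have cw3 := hw.dx.dx.dx.cont_x t
    have cw4 := hw.dx.dx.dx.dx.cont_x t
    have cv1 := hv.dx.cont_x t
    have cv2 := hv.dx.dx.cont_x t
    have cv3 := hv.dx.dx.dx.cont_x t
    have cv4 := hv.dx.dx.dx.dx.cont_x t
    have cwt := hw.dt.cont_x t
    have cvt := hv.dt.cont_x t
    have cwtx := hw.dt.dx.cont_x t
    have cvtx := hv.dt.dx.cont_x t
    have cwtxx := hw.dt.dx.dx.cont_x t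
    have cvtxx := hv.dt.dx.dx.cont_x t
    have cF : Continuous fun x => eFluxX w v x t := by
      unfold eFluxX cAxx cG cAx cA; fun_prop
    have cR : Continuous fun x => eRem D w v x t := by
      unfold eRem cAt cGx cG; fun_prop
    have cE : Continuous fun x => eDens D w v x t := he.cont_x t
    have z0 : pdt w 0 t - pdt v 0 t = 0 :=
      deriv_zero_of_zero_on hT ht (fun s hs => sub_eq_zero.2 (hb0 s hs))
        ((hw.ht 0 t).sub (hv.ht 0 t))
    have z1 : pdx (pdt w) 0 t - pdx (pdt v) 0 t = 0 := by
      rw [← hw.comm, ← hv.comm]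
      exact deriv_zero_of_zero_on hT ht (fun s hs => sub_eq_zero.2 (hb1 s hs))
        ((hw.dx.ht 0 t).sub (hv.dx.ht 0 t))
    have hflux : ∫ x in (0:ℝ)..L, eFluxX w v x t = 0 := by
      rw [intervalIntegral.integral_eq_sub_of_hasDerivAt (fun x _ => eFlux_x hw hv x t)
        (cF.intervalIntegrable _ _)]
      simp only [eFlux, z0, z1, hb2 t ht, hb3 t ht]
      ring
    have s1 : ∫ x in (0:ℝ)..L, pdt (eDens D w v) x t = ∫ x in (0:ℝ)..L, eRem D w v x t := by
      have : ∫ x in (0:ℝ)..L, pdt (eDens D w v) x t =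
          ∫ x in (0:ℝ)..L, (2 * D * eFluxX w v x t + eRem D w v x t) := by
        apply intervalIntegral.integral_congr
        intro x hx
        rw [uIcc_of_le hL.le] at hx
        exact (eDens_t hw hv D x t (hpde x hx t ht)).deriv
      rw [this, intervalIntegral.integral_add ((cF.const_mul _).intervalIntegrable _ _)
        (cR.intervalIntegrable _ _), intervalIntegral.integral_const_mul, hflux]
      ring
    have hP := poincare (f := fun x => pdx w x t - pdx v x t)
      (f' := fun x => pdx (pdx w) x t - pdx (pdx v) x t) hL
      (fun x => (hw.dx.hx x t).sub (hv.dx.hx x t)) (by fun_prop)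
      (sub_eq_zero.2 (hb1 t ht))
    have s2 : ∫ x in (0:ℝ)..L, eRem D w v x t ≤ ∫ x in (0:ℝ)..L,
        (M * ((pdt w x t - pdt v x t) ^ 2 + 2 * (pdx (pdx w) x t - pdx (pdx v) x t) ^ 2)
          + M * (pdx w x t - pdx v x t) ^ 2) := by
      apply intervalIntegral.integral_mono_on hL.le (cR.intervalIntegrable _ _)
        ((by fun_prop : Continuous _).intervalIntegrable _ _)
      intro x hx
      obtain ⟨a, b, c⟩ := hM x hx t ht
      have := rem_alg (z := pdt w x t - pdt v x t) (p := pdx w x t - pdx v x t)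
        (q := pdx (pdx w) x t - pdx (pdx v) x t) a b c
      unfold eRem
      linarith
    have s3 : ∫ x in (0:ℝ)..L,
        (M * ((pdt w x t - pdt v x t) ^ 2 + 2 * (pdx (pdx w) x t - pdx (pdx v) x t) ^ 2)
          + M * (4 * L ^ 2 * (pdx (pdx w) x t - pdx (pdx v) x t) ^ 2)) ≤
        ∫ x in (0:ℝ)..L, C * eDens D w v x t := by
      apply intervalIntegral.integral_mono_on hL.le
        ((by fun_prop : Continuous _).intervalIntegrable _ _)
        ((cE.const_mul C).intervalIntegrable _ _)
      intro x hx
      have hA := cA_ge (w := w) (v := v) x t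
      unfold eDens
      generalize cA w v x t = A at *
      generalize pdt w x t - pdt v x t = z
      generalize pdx (pdx w) x t - pdx (pdx v) x t = q
      have e1 : (1 + (2 + 4 * L ^ 2) / D) * (z ^ 2 + D * (A * q ^ 2)) =
        z ^ 2 + (2 + 4 * L ^ 2) / D * z ^ 2 + D * (A * q ^ 2) + (2 + 4 * L ^ 2) * (A * q ^ 2) := by
        field_simp
        ring
      have e2 : q ^ 2 ≤ A * q ^ 2 := by nlinarith [sq_nonneg q]
      have e3 : 0 ≤ (2 + 4 * L ^ 2) / D * z ^ 2 := by positivity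
      have e4 : 0 ≤ D * (A * q ^ 2) := by positivity
      have e5 : (2 + 4 * L ^ 2) * q ^ 2 ≤ (2 + 4 * L ^ 2) * (A * q ^ 2) := by gcongr
      rw [hC, mul_assoc M (1 + _), e1, ← mul_add]
      apply mul_le_mul_of_nonneg_left _ hM0
      linarith
    rw [s1]
    refine s2.trans (le_trans ?_ (s3.trans_eq (intervalIntegral.integral_const_mul _ _)))
    rw [intervalIntegral.integral_add, intervalIntegral.integral_add,
      intervalIntegral.integral_const_mul (r := M) (f := fun x => (pdx w x t - pdx v x t) ^ 2),
      intervalIntegral.integral_const_mul (r := M)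
        (f := fun x => 4 * L ^ 2 * (pdx (pdx w) x t - pdx (pdx v) x t) ^ 2)]
    · have := mul_le_mul_of_nonneg_left hP hM0
      linarith
    all_goals exact (by fun_prop : Continuous _).intervalIntegrable _ _
  -- initial energy
  have hE0 : E 0 = 0 := by
    have i1 : ∀ x ∈ Icc (0:ℝ) L, pdx w x 0 - pdx v x 0 = 0 := fun x hx =>
      deriv_zero_of_zero_on hL hx (fun s hs => sub_eq_zero.2 (h0 s hs))
        ((hw.hx x 0).sub (hv.hx x 0))
    have i2 : ∀ x ∈ Icc (0:ℝ) L, pdx (pdx w) x 0 - pdx (pdx v) x 0 = 0 := fun x hx =>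
      deriv_zero_of_zero_on hL hx i1 ((hw.dx.hx x 0).sub (hv.dx.hx x 0))
    have : E 0 = ∫ x in (0:ℝ)..L, (0:ℝ) := by
      apply intervalIntegral.integral_congr
      intro x hx
      rw [uIcc_of_le hL.le] at hx
      simp [eDens, i2 x hx, h1 x hx]
    simpa using this
  -- Gronwall
  have hg : ∀ t, HasDerivAt (fun t => Real.exp (-C * t) * E t)
      (Real.exp (-C * t) * ((∫ x in (0:ℝ)..L, pdt (eDens D w v) x t) - C * E t)) t := by
    intro t
    refine ((((hasDerivAt_id t).const_mul (-C)).exp).mul (hEd t)).congr_deriv ?_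
    simp; ring
  have hanti : AntitoneOn (fun t => Real.exp (-C * t) * E t) (Icc 0 T) := by
    apply antitoneOn_of_deriv_nonpos (convex_Icc 0 T)
    · exact fun t _ => (hg t).continuousAt.continuousWithinAt
    · exact fun t _ => (hg t).differentiableAt.differentiableWithinAt
    · intro t ht
      rw [(hg t).deriv]
      exact mul_nonpos_of_nonneg_of_nonpos (Real.exp_pos _).le
        (sub_nonpos.2 (hineq t (interior_subset ht)))
  have hEt : ∀ t ∈ Icc (0:ℝ) T, E t ≤ 0 := by
    intro t ht
    have := hanti (left_mem_Icc.2 hT.le) ht ht.1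
    simp only [hE0, mul_zero] at this
    exact nonpos_of_mul_nonpos_right this (Real.exp_pos _)
  have hut : ∀ x ∈ Icc (0:ℝ) L, ∀ t ∈ Icc (0:ℝ) T, pdt w x t - pdt v x t = 0 := by
    intro x hx t ht
    by_contra hne
    have : 0 < E t := by
      apply intervalIntegral.integral_pos hL (he.cont_x t).continuousOn (fun y _ => hpos y t)
      refine ⟨x, hx, ?_⟩
      have := cA_ge (w := w) (v := v) x t
      unfold eDens
      positivity
    exact absurd (hEt t ht) (not_le.2 this)
  intro x hx t ht
  have hd : ∀ s, HasDerivAt (fun s => w x s - v x s) (pdt w x s - pdt v x s) s := fun s =>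
    (hw.ht x s).sub (hv.ht x s)
  have := constant_of_has_deriv_right_zero (f := fun s => w x s - v x s) (a := 0) (b := T)
    (fun s _ => (hd s).continuousAt.continuousWithinAt)
    (fun s hs => by
      have := (hd s).hasDerivWithinAt (s := Ici s)
      rwa [hut x hx s ⟨hs.1, hs.2.le⟩] at this) t ht
  simp only [h0 x hx, sub_self] at this
  exact sub_eq_zero.1 this

end Core

/-- Uniqueness of classical solutions of the stiffness-only inextensible cantilever
system (Theorem 4.1): two solutions with the same initial data coincide. -/
theorem stiffness_uniqueness
    (L D T : ℝ) (hL : 0 < L) (hD : 0 < D) (hT : 0 < T)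
    (p w v : ℝ → ℝ → ℝ) (hp : ContDiff ℝ (⊤ : ℕ∞) (fun q : ℝ × ℝ => p q.1 q.2))
    (hw : IsStiffSol L D T p w) (hv : IsStiffSol L D T p v)
    (h0 : ∀ x ∈ Icc (0:ℝ) L, w x 0 = v x 0)
    (h1 : ∀ x ∈ Icc (0:ℝ) L, pdt w x 0 = pdt v x 0) :
    ∀ x ∈ Icc (0:ℝ) L, ∀ t ∈ Icc (0:ℝ) T, w x t = v x t := by
  set K := Icc (0:ℝ) L ×ˢ Icc (0:ℝ) T with hK
  have hKc : IsClosed K := isClosed_Icc.prod isClosed_Icc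
  obtain ⟨⟨U, hU, hKU, hwU⟩, hwp, hwb⟩ := hw
  obtain ⟨⟨U', hU', hKU', hvU⟩, hvp, hvb⟩ := hv
  obtain ⟨W, hW, hWw⟩ := exists_ext hKc hU hKU hwU
  obtain ⟨V, hV, hVv⟩ := exists_ext hKc hU' hKU' hvU
  have l0 : (0:ℝ) ∈ Icc 0 L := left_mem_Icc.2 hL.le
  have l1 : L ∈ Icc 0 L := right_mem_Icc.2 hL.le
  have t0 : (0:ℝ) ∈ Icc 0 T := left_mem_Icc.2 hT.le
  have key := core hW hV hL hD hT
    (fun x hx t ht => by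
      rw [stiffOp_congr (q := (x, t)) D (hWw (x, t) ⟨hx, ht⟩),
        stiffOp_congr (q := (x, t)) D (hVv (x, t) ⟨hx, ht⟩)]
      exact (hwp x hx t ht).trans (hvp x hx t ht).symm)
    (fun t ht => by
      have a := (hWw (0, t) ⟨l0, ht⟩).self_of_nhds
      have b := (hVv (0, t) ⟨l0, ht⟩).self_of_nhds
      exact (a.trans (hwb t ht).1).trans (b.trans (hvb t ht).1).symm)
    (fun t ht => by
      have a := (pdx_congr_s12 (hWw (0, t) ⟨l0, ht⟩)).self_of_nhds
      have b := (pdx_congr_s12 (hVv (0, t) ⟨l0, ht⟩)).self_of_nhds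
      exact (a.trans (hwb t ht).2.1).trans (b.trans (hvb t ht).2.1).symm)
    (fun t ht => by
      have a := (pdx_congr_s12 (pdx_congr_s12 (hWw (L, t) ⟨l1, ht⟩))).self_of_nhds
      have b := (pdx_congr_s12 (pdx_congr_s12 (hVv (L, t) ⟨l1, ht⟩))).self_of_nhds
      exact (a.trans (hwb t ht).2.2.1).trans (b.trans (hvb t ht).2.2.1).symm)
    (fun t ht => by
      have a := (pdx_congr_s12 (pdx_congr_s12 (pdx_congr_s12 (hWw (L, t) ⟨l1, ht⟩)))).self_of_nhds
      have b := (pdx_congr_s12 (pdx_congr_s12 (pdx_congr_s12 (hVv (L, t) ⟨l1, ht⟩)))).self_of_nhds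
      exact (a.trans (hwb t ht).2.2.2).trans (b.trans (hvb t ht).2.2.2).symm)
    (fun x hx => by
      have a := (hWw (x, 0) ⟨hx, t0⟩).self_of_nhds
      have b := (hVv (x, 0) ⟨hx, t0⟩).self_of_nhds
      exact (a.trans (h0 x hx)).trans b.symm)
    (fun x hx => by
      have a := (pdt_congr_s12 (hWw (x, 0) ⟨hx, t0⟩)).self_of_nhds
      have b := (pdt_congr_s12 (hVv (x, 0) ⟨hx, t0⟩)).self_of_nhds
      exact (a.trans (h1 x hx)).trans b.symm)
  intro x hx t ht
  have a := (hWw (x, t) ⟨hx, ht⟩).self_of_nhds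
  have b := (hVv (x, t) ⟨hx, ht⟩).self_of_nhds
  exact (a.symm.trans (key x hx t ht)).trans b
end
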